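/- arXiv:2404.12946 — 2 statements merged into one kernel-verified Lean document; each statement's English description precedes it below -/
import Mathlib

section
/- Let T be an (α,β)-RK operator on a complex Banach space X with α, β ≥ 0, β < 1 and α + β < 1. Then σ(T) ⊆ 𝔻, i.e. the spectral radius of T satisfies r(T) < 1. -/
/-- A bounded linear operator `T` on a complex Banach space is `(α,β)`-RK with constant `C` if
`C ≥ 1` and for every `λ ∈ ℂ` with `|λ| > 1` the operator `λI − T` is invertible with
`‖(λI − T)⁻¹‖ ≤ C |λ|^(α+β−1) / (|λ−1|^α (|λ|−1)^β)`. -/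
def IsRK {X : Type*} [NormedAddCommGroup X] [NormedSpace ℂ X]
    (T : X →L[ℂ] X) (α β C : ℝ) : Prop :=
  1 ≤ C ∧ ∀ lam : ℂ, 1 < ‖lam‖ →
    IsUnit (algebraMap ℂ (X →L[ℂ] X) lam - T) ∧
    ‖Ring.inverse (algebraMap ℂ (X →L[ℂ] X) lam - T)‖ ≤
      C * ‖lam‖ ^ (α + β - 1) / (‖lam - 1‖ ^ α * (‖lam‖ - 1) ^ β)

/-- In a Banach algebra over `ℂ`, the norm of the resolvent at `lam` is at least the reciprocal of
the distance from `lam` to any spectral value. -/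
theorem one_le_norm_inverse_mul_norm_sub {A : Type*} [NormedRing A] [NormedAlgebra ℂ A]
    [CompleteSpace A] [NormOneClass A] {a : A} {lam mu : ℂ} (hmu : mu ∈ spectrum ℂ a)
    (hlam : IsUnit (algebraMap ℂ A lam - a)) :
    1 ≤ ‖Ring.inverse (algebraMap ℂ A lam - a)‖ * ‖lam - mu‖ := by
  obtain ⟨u, hu⟩ := hlam
  rw [← hu, Ring.inverse_unit]
  by_contra! h
  refine hmu ?_
  have : Nontrivial A := NormOneClass.nontrivial
  have hpos : 0 < ‖(↑u⁻¹ : A)‖ := Units.norm_pos _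
  have hnear : ‖algebraMap ℂ A mu - a - u‖ < ‖(↑u⁻¹ : A)‖⁻¹ := by
    have heq : algebraMap ℂ A mu - a - u = algebraMap ℂ A (mu - lam) := by
      rw [hu, map_sub]; abel
    rw [heq, norm_algebraMap', norm_sub_rev, ← one_div, lt_div_iff₀' hpos]
    exact h
  exact (u.ofNearby _ hnear).isUnit

/-- For `|mu| = 1`, the `(α,β)`-RK bound at `(1 + t) mu` is at most `C / t ^ (α + β)`. -/
theorem IsRK.norm_inverse_le {X : Type*} [NormedAddCommGroup X] [NormedSpace ℂ X]
    {T : X →L[ℂ] X} {α β C t : ℝ} {mu : ℂ} (hT : IsRK T α β C) (hα : 0 ≤ α)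
    (hsum : α + β < 1) (ht : 0 < t) (hmu : ‖mu‖ = 1) :
    ‖Ring.inverse (algebraMap ℂ (X →L[ℂ] X) ((1 + t : ℝ) * mu) - T)‖ ≤ C / t ^ (α + β) := by
  have hnorm : ‖((1 + t : ℝ) : ℂ) * mu‖ = 1 + t := by
    rw [norm_mul, hmu, mul_one, Complex.norm_real, Real.norm_of_nonneg (by linarith)]
  have hC : 0 ≤ C := zero_le_one.trans hT.1
  refine (hT.2 _ (by rw [hnorm]; linarith)).2.trans ?_
  have hsub : t ≤ ‖((1 + t : ℝ) : ℂ) * mu - 1‖ := by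
    have := norm_sub_norm_le (((1 + t : ℝ) : ℂ) * mu) 1
    rw [hnorm, norm_one] at this
    linarith
  rw [hnorm, add_sub_cancel_left, Real.rpow_add ht]
  have hone : (1 + t) ^ (α + β - 1) ≤ 1 :=
    Real.rpow_le_one_of_one_le_of_nonpos (by linarith) (by linarith)
  gcongr
  exact mul_le_of_le_one_right hC hone

/-- For an `(α,β)`-RK operator with `β < 1` and `α + β < 1`, the spectrum is contained in the
open unit disk; equivalently the spectral radius is `< 1`. -/
theorem spectrum_subset_ball_of_sum_lt_one
    {X : Type*} [NormedAddCommGroup X] [NormedSpace ℂ X] [CompleteSpace X]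
    (T : X →L[ℂ] X) (α β C : ℝ) (hα : 0 ≤ α) (hβ : 0 ≤ β) (hβ1 : β < 1)
    (hsum : α + β < 1) (hT : IsRK T α β C) :
    spectrum ℂ T ⊆ Metric.ball (0 : ℂ) 1 ∧ spectralRadius ℂ T < 1 := by
  rcases subsingleton_or_nontrivial X with hX | hX
  · have : Subsingleton (X →L[ℂ] X) := inferInstance
    simp [spectralRadius, spectrum.of_subsingleton]
  have hball : spectrum ℂ T ⊆ Metric.ball (0 : ℂ) 1 := by
    intro mu hmu
    rw [mem_ball_zero_iff]
    by_contra! hge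
    have hmu1 : ‖mu‖ = 1 := hge.antisymm' (not_lt.1 fun hgt => hmu (hT.2 mu hgt).1)
    have hs : 0 < 1 - (α + β) := by linarith
    have hC : 0 < C := zero_lt_one.trans_le hT.1
    obtain ⟨t, ht, hts⟩ : ∃ t : ℝ, 0 < t ∧ t ^ (1 - (α + β)) = (2 * C)⁻¹ :=
      ⟨(2 * C)⁻¹ ^ (1 - (α + β))⁻¹, by positivity,
        Real.rpow_inv_rpow (by positivity) hs.ne'⟩
    have hunit := (hT.2 ((1 + t : ℝ) * mu) (by
      rw [norm_mul, hmu1, mul_one, Complex.norm_real, Real.norm_of_nonneg (by linarith)]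
      linarith)).1
    have hlow := one_le_norm_inverse_mul_norm_sub hmu hunit
    have hdist : ‖((1 + t : ℝ) : ℂ) * mu - mu‖ = t := by
      have : ((1 + t : ℝ) : ℂ) * mu - mu = (t : ℂ) * mu := by push_cast; ring
      rw [this, norm_mul, hmu1, mul_one, Complex.norm_real, Real.norm_of_nonneg ht.le]
    rw [hdist] at hlow
    have hup := mul_le_mul_of_nonneg_right (hT.norm_inverse_le hα hsum ht hmu1) ht.le
    have heq : C / t ^ (α + β) * t = 1 / 2 := by
      rw [Real.rpow_sub ht, Real.rpow_one] at hts
      rw [div_mul_eq_mul_div, mul_div_assoc, hts]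
      field_simp
    linarith
  refine ⟨hball, ?_⟩
  refine spectrum.spectralRadius_lt_of_forall_lt T fun z hz => ?_
  exact mem_ball_zero_iff.1 (hball hz)
end

section
/- Let T be an (α,β)-RK operator on a complex Banach space X with α, β ≥ 0, and let k ∈ ℕ ∪ {0} satisfy α(k+1) > 1. Then there exist a constant M > 0 and N ∈ ℕ such that ‖T^n‖ ≤ M n^{(α+β−1)(k+1)} for all n ≥ N. -/
open scoped Nat Topology
open Real Set

/-- Cauchy estimate for the Taylor coefficients of `z ↦ (1 - z a)⁻ᵏ⁻¹`. -/
theorem choose_mul_norm_pow_le_circle_average {A : Type*} [NormedRing A] [NormedAlgebra ℂ A]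
    [CompleteSpace A] (a : A) (k n : ℕ) {r : ℝ} (hr : 0 < r)
    (hu : ∀ z : ℂ, ‖z‖ ≤ r → IsUnit (1 - z • a)) :
    ((n + k).choose k : ℝ) * ‖a ^ n‖ ≤
      ((2 * π)⁻¹ * ∫ θ in 0..2 * π, ‖Ring.inverse (1 - circleMap 0 r θ • a) ^ (k + 1)‖) *
        r⁻¹ ^ n := by
  set F : ℂ → A := fun z => Ring.inverse (1 - z • a) ^ (k + 1) with hF
  lift r to NNReal using hr.le
  have hd : DifferentiableOn ℂ F (Metric.closedBall 0 r) := by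
    intro z hz
    have h1 : DifferentiableAt ℂ (Ring.inverse (M₀ := A)) (1 - z • a) :=
      differentiableAt_inverse (hu z (by simpa using hz))
    have h2 : DifferentiableAt ℂ (fun z : ℂ => 1 - z • a) z := by fun_prop
    exact ((h1.comp z h2).pow (k + 1)).differentiableWithinAt
  have h1 := (hd.hasFPowerSeriesOnBall (by exact_mod_cast hr)).hasFPowerSeriesAt
  let p : FormalMultilinearSeries ℂ ℂ A := fun m =>
    ContinuousMultilinearMap.mkPiRing ℂ (Fin m) (((m + k).choose k : A) * a ^ m)
  have hp : ∀ m, p.coeff m = ((m + k).choose k : A) * a ^ m := by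
    intro m
    simp [p, FormalMultilinearSeries.coeff]
  have h2 : HasFPowerSeriesAt F p 0 := by
    rw [hasFPowerSeriesAt_iff]
    have hc : Filter.Tendsto (fun z : ℂ => ‖z • a‖) (𝓝 0) (𝓝 0) := by
      have : Continuous fun z : ℂ => ‖z • a‖ := by fun_prop
      simpa using this.tendsto 0
    filter_upwards [hc.eventually_lt_const one_pos] with z hz
    have := hasSum_choose_mul_geometric_of_norm_lt_one' k hz
    simp only [hp, zero_add, hF]
    convert! this using 2 with m
    rw [smul_pow, mul_smul_comm]
  have h3 := h1.eq_formalMultilinearSeries h2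
  have h4 := norm_cauchyPowerSeries_le F 0 r n
  rw [h3, FormalMultilinearSeries.norm_apply_eq_norm_coef, hp, abs_of_pos hr] at h4
  refine le_trans (le_of_eq ?_) h4
  rw [← nsmul_eq_mul _ (a ^ n), ← Nat.cast_smul_eq_nsmul ℝ, norm_smul, Real.norm_natCast]

theorem IsRK.isUnit_one_sub_smul {X : Type*} [NormedAddCommGroup X] [NormedSpace ℂ X]
    {T : X →L[ℂ] X} {α β C : ℝ} (hT : IsRK T α β C) {w : ℂ} (hw : ‖w‖ < 1) :
    IsUnit (1 - w • T) := by
  rcases eq_or_ne w 0 with rfl | h0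
  · simp
  have hl : 1 < ‖w⁻¹‖ := by
    rw [norm_inv]; exact (one_lt_inv₀ (norm_pos_iff.2 h0)).2 hw
  have := ((isUnit_iff_ne_zero.2 h0).map (algebraMap ℂ (X →L[ℂ] X))).mul (hT.2 _ hl).1
  rwa [mul_sub, ← map_mul, mul_inv_cancel₀ h0, map_one, ← Algebra.smul_def] at this

theorem IsRK.norm_inverse_one_sub_smul_le {X : Type*} [NormedAddCommGroup X] [NormedSpace ℂ X]
    {T : X →L[ℂ] X} {α β C : ℝ} (hT : IsRK T α β C) {w : ℂ} (h0 : w ≠ 0) (hw : ‖w‖ < 1) :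
    ‖Ring.inverse (1 - w • T)‖ ≤ C * ‖1 - w‖ ^ (-α) * (1 - ‖w‖) ^ (-β) := by
  have hw0 := norm_pos_iff.2 h0
  have hl : 1 < ‖w⁻¹‖ := by
    rw [norm_inv]; exact (one_lt_inv₀ hw0).2 hw
  obtain ⟨hu, hb⟩ := hT.2 _ hl
  have e : 1 - w • T = w • (algebraMap ℂ (X →L[ℂ] X) w⁻¹ - T) := by
    rw [smul_sub, Algebra.algebraMap_eq_smul_one, smul_smul, mul_inv_cancel₀ h0, one_smul]
  have e2 : Ring.inverse (1 - w • T) =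
      w⁻¹ • Ring.inverse (algebraMap ℂ (X →L[ℂ] X) w⁻¹ - T) := by
    rw [← mul_one (Ring.inverse (1 - w • T)),
      Ring.inverse_mul_eq_iff_eq_mul _ _ _ (hT.isUnit_one_sub_smul hw), e,
      smul_mul_smul_comm, mul_inv_cancel₀ h0, one_smul, Ring.mul_inverse_cancel _ hu]
  have hw1 : 0 < ‖1 - w‖ := by
    rw [norm_pos_iff, sub_ne_zero]
    rintro rfl
    simp at hw
  have hd : 0 < 1 - ‖w‖ := by linarith
  have e3 : ‖w⁻¹ - 1‖ = ‖1 - w‖ * ‖w‖⁻¹ := by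
    rw [← norm_inv, ← norm_mul, sub_mul, one_mul, mul_inv_cancel₀ h0]
  have e4 : ‖w⁻¹‖ - 1 = (1 - ‖w‖) * ‖w‖⁻¹ := by
    rw [norm_inv, sub_mul, one_mul, mul_inv_cancel₀ hw0.ne']
  rw [e2, norm_smul]
  refine (mul_le_mul_of_nonneg_left hb (norm_nonneg _)).trans (le_of_eq ?_)
  have hi := inv_pos.2 hw0
  rw [e3, e4, norm_inv, mul_rpow hw1.le hi.le, mul_rpow hd.le hi.le, rpow_neg hw1.le,
    rpow_neg hd.le, rpow_sub_one hi.ne', rpow_add hi]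
  have := rpow_pos_of_pos hi α
  have := rpow_pos_of_pos hi β
  have := rpow_pos_of_pos hw1 α
  have := rpow_pos_of_pos hd β
  generalize ‖w‖⁻¹ ^ α = x at *
  generalize ‖w‖⁻¹ ^ β = y at *
  field_simp

theorem norm_one_sub_circleMap_sq (r θ : ℝ) :
    ‖1 - circleMap 0 r θ‖ ^ 2 = (1 - r) ^ 2 + 4 * r * sin (θ / 2) ^ 2 := by
  have h1 : sin (θ / 2) ^ 2 = 1 / 2 - cos θ / 2 := by
    rw [sin_sq_eq_half_sub, mul_div_cancel₀ _ two_ne_zero]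
  rw [h1, ← Complex.normSq_eq_norm_sq, Complex.normSq_apply, circleMap_zero]
  simp [Complex.exp_ofReal_mul_I_re, Complex.exp_ofReal_mul_I_im]
  linear_combination r ^ 2 * sin_sq_add_cos_sq θ

theorem one_sub_add_le_norm_one_sub_circleMap {r θ t : ℝ} (hr : 1 / 2 ≤ r) (hr1 : r < 1)
    (ht : 0 ≤ t) (htπ : t ≤ π) (hs : sin (t / 2) ^ 2 = sin (θ / 2) ^ 2) :
    (1 - r) + t ≤ 5 * ‖1 - circleMap 0 r θ‖ := by
  have h := norm_one_sub_circleMap_sq r θ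
  have h0 := norm_nonneg (1 - circleMap 0 r θ)
  have hj := mul_le_sin (x := t / 2) (by linarith) (by linarith)
  have hj' : t / 4 ≤ sin (t / 2) := by
    refine le_trans ?_ hj
    rw [div_mul_eq_mul_div, le_div_iff₀ pi_pos]
    nlinarith [pi_le_four]
  have h1 : 1 - r ≤ ‖1 - circleMap 0 r θ‖ := by
    refine le_of_sq_le_sq ?_ h0
    rw [h]; nlinarith [sq_nonneg (sin (θ / 2))]
  have h2 : t / 4 ≤ ‖1 - circleMap 0 r θ‖ := by
    refine le_of_sq_le_sq ?_ h0
    rw [h, ← hs]; nlinarith [sq_nonneg (sin (t / 2)), sq_nonneg (1 - r)]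
  linarith

theorem norm_one_sub_circleMap_rpow_neg_le {r θ s : ℝ} (hr : 1 / 2 ≤ r) (hr1 : r < 1)
    (hθ : 0 ≤ θ) (hθ' : θ ≤ 2 * π) (hs : 0 ≤ s) :
    ‖1 - circleMap 0 r θ‖ ^ (-s) ≤
      5 ^ s * ((1 - r + θ) ^ (-s) + (1 - r + (2 * π - θ)) ^ (-s)) := by
  have key : ∀ t : ℝ, 0 ≤ t → t ≤ π → sin (t / 2) ^ 2 = sin (θ / 2) ^ 2 →
      ‖1 - circleMap 0 r θ‖ ^ (-s) ≤ 5 ^ s * (1 - r + t) ^ (-s) := by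
    intro t ht htπ he
    have h := one_sub_add_le_norm_one_sub_circleMap hr hr1 ht htπ he
    have hp : 0 < 1 - r + t := by linarith
    have h' : (1 - r + t) / 5 ≤ ‖1 - circleMap 0 r θ‖ := by linarith
    refine (rpow_le_rpow_of_nonpos (by positivity) h' (by linarith)).trans (le_of_eq ?_)
    rw [div_rpow hp.le (by norm_num), rpow_neg (by norm_num : (0 : ℝ) ≤ 5), div_inv_eq_mul,
      mul_comm]
  have p1 : 0 ≤ (1 - r + θ) ^ (-s) := rpow_nonneg (by linarith) _
  have p2 : 0 ≤ (1 - r + (2 * π - θ)) ^ (-s) := rpow_nonneg (by linarith) _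
  have p5 : (0 : ℝ) ≤ 5 ^ s := by positivity
  rcases le_total θ π with h | h
  · refine (key θ hθ h rfl).trans ?_
    gcongr; linarith
  · refine (key (2 * π - θ) (by linarith) (by linarith) ?_).trans ?_
    · rw [show (2 * π - θ) / 2 = π - θ / 2 by ring, sin_pi_sub]
    · gcongr; linarith

theorem integral_add_rpow_neg_le {d s b : ℝ} (hd : 0 < d) (hs : 1 < s) (hb : 0 ≤ b) :
    ∫ θ in 0..b, (d + θ) ^ (-s) ≤ d ^ (1 - s) / (s - 1) := by
  rw [intervalIntegral.integral_comp_add_left (fun x => x ^ (-s)), integral_rpow]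
  · have : 0 ≤ (d + b) ^ (1 - s) := rpow_nonneg (by linarith) _
    rw [show -s + 1 = 1 - s by ring, ← neg_sub s 1, div_neg, ← neg_div, add_zero]
    have : 0 < s - 1 := by linarith
    rw [neg_sub s 1]
    gcongr
    linarith
  · right
    refine ⟨by linarith, ?_⟩
    rw [uIcc_of_le (by linarith)]
    intro h
    linarith [h.1]

theorem integral_norm_one_sub_circleMap_rpow_neg_le {r s : ℝ} (hr : 1 / 2 ≤ r) (hr1 : r < 1)
    (hs : 1 < s) :
    ∫ θ in 0..2 * π, ‖1 - circleMap 0 r θ‖ ^ (-s) ≤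
      5 ^ s * (2 * ((1 - r) ^ (1 - s) / (s - 1))) := by
  have hpi := pi_pos
  have hd : 0 < 1 - r := by linarith
  have c1 : IntervalIntegrable (fun θ : ℝ => (1 - r + θ) ^ (-s)) MeasureTheory.volume 0 (2 * π) := by
    refine ContinuousOn.intervalIntegrable ?_
    rw [uIcc_of_le (by linarith)]
    refine ContinuousOn.rpow_const (by fun_prop) fun x hx => Or.inl ?_
    linarith [hx.1]
  have c2 : IntervalIntegrable (fun θ : ℝ => (1 - r + (2 * π - θ)) ^ (-s))
      MeasureTheory.volume 0 (2 * π) := by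
    refine ContinuousOn.intervalIntegrable ?_
    rw [uIcc_of_le (by linarith)]
    refine ContinuousOn.rpow_const (by fun_prop) fun x hx => Or.inl ?_
    linarith [hx.2]
  have c3 : IntervalIntegrable (fun θ : ℝ => ‖1 - circleMap 0 r θ‖ ^ (-s))
      MeasureTheory.volume 0 (2 * π) := by
    refine Continuous.intervalIntegrable ?_ _ _
    refine Continuous.rpow_const (by fun_prop) fun x => Or.inl ?_
    have := norm_one_sub_circleMap_sq r x
    intro h0
    rw [h0] at this
    nlinarith [sq_nonneg (sin (x / 2))]
  refine (intervalIntegral.integral_mono_on (by linarith) c3 ((c1.add c2).const_mul _)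
    fun θ hθ => norm_one_sub_circleMap_rpow_neg_le hr hr1 hθ.1 hθ.2 (by linarith)).trans ?_
  rw [intervalIntegral.integral_const_mul, intervalIntegral.integral_add c1 c2,
    intervalIntegral.integral_comp_sub_left (fun x => (1 - r + x) ^ (-s))]
  have := integral_add_rpow_neg_le hd hs (b := 2 * π) (by linarith)
  simp only [sub_self, sub_zero]
  gcongr
  linarith

theorem inv_one_sub_inv_pow_le_exp_two {n : ℕ} (hn : 2 ≤ n) :
    ((1 - (n : ℝ)⁻¹)⁻¹) ^ n ≤ exp 2 := by
  have hn' : (2 : ℝ) ≤ n := by exact_mod_cast hn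
  have hi : (n : ℝ)⁻¹ ≤ 1 / 2 := by
    rw [inv_le_comm₀ (by linarith) (by norm_num)]; norm_num; exact hn
  have hi0 : 0 < (n : ℝ)⁻¹ := by positivity
  have h1 : (1 - (n : ℝ)⁻¹)⁻¹ ≤ exp (2 * (n : ℝ)⁻¹) := by
    refine le_trans ?_ (add_one_le_exp _)
    rw [inv_le_iff_one_le_mul₀ (by linarith)]
    nlinarith
  calc ((1 - (n : ℝ)⁻¹)⁻¹) ^ n ≤ exp (2 * (n : ℝ)⁻¹) ^ n :=
        pow_le_pow_left₀ (inv_nonneg.2 (by linarith)) h1 n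
    _ = exp 2 := by
        rw [← exp_nat_mul]; congr 1; field_simp

theorem IsRK.integral_norm_inverse_pow_le {X : Type*} [NormedAddCommGroup X] [NormedSpace ℂ X]
    [CompleteSpace X] {T : X →L[ℂ] X} {α β C : ℝ} (hT : IsRK T α β C) {k : ℕ}
    (hk : 1 < α * (k + 1)) {r : ℝ} (hr : 1 / 2 ≤ r) (hr1 : r < 1) :
    ∫ θ in 0..2 * π, ‖Ring.inverse (1 - circleMap 0 r θ • T) ^ (k + 1)‖ ≤
      C ^ (k + 1) * (1 - r) ^ (-(β * (k + 1))) *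
        (5 ^ (α * (k + 1)) * (2 * ((1 - r) ^ (1 - α * (k + 1)) / (α * (k + 1) - 1)))) := by
  have hd : 0 < 1 - r := by linarith
  have hC : 0 ≤ C := zero_le_one.trans hT.1
  have hnorm : ∀ θ, ‖circleMap 0 r θ‖ = r := fun θ => by
    rw [norm_circleMap_zero, abs_of_pos (by linarith)]
  have hpos : ∀ θ, ‖1 - circleMap 0 r θ‖ ≠ 0 := by
    intro θ h0
    rw [norm_eq_zero, sub_eq_zero] at h0
    have := hnorm θ
    rw [← h0, norm_one] at this
    linarith
  have c1 : Continuous fun θ : ℝ => ‖Ring.inverse (1 - circleMap 0 r θ • T) ^ (k + 1)‖ := by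
    refine (Continuous.pow ?_ _).norm
    refine continuous_iff_continuousAt.2 fun θ => ?_
    have h1 : ContinuousAt (Ring.inverse (M₀ := X →L[ℂ] X)) (1 - circleMap 0 r θ • T) :=
      (differentiableAt_inverse (𝕜 := ℂ)
        (hT.isUnit_one_sub_smul (by rw [hnorm]; exact hr1))).continuousAt
    have h2 : Continuous fun θ : ℝ => 1 - circleMap 0 r θ • T := by fun_prop
    exact ContinuousAt.comp (f := fun θ : ℝ => 1 - circleMap 0 r θ • T) h1 h2.continuousAt
  have c2 : Continuous fun θ : ℝ => C ^ (k + 1) * (1 - r) ^ (-(β * (k + 1))) *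
      ‖1 - circleMap 0 r θ‖ ^ (-(α * (k + 1))) :=
    continuous_const.mul (Continuous.rpow_const (by fun_prop) fun θ => Or.inl (hpos θ))
  refine (intervalIntegral.integral_mono_on (by positivity) (c1.intervalIntegrable _ _)
    (c2.intervalIntegrable _ _) fun θ _ => ?_).trans ?_
  · refine (norm_pow_le' _ k.succ_pos).trans ?_
    have h := hT.norm_inverse_one_sub_smul_le (w := circleMap 0 r θ)
      (norm_pos_iff.1 (by rw [hnorm]; linarith)) (by rw [hnorm]; exact hr1)
    refine (pow_le_pow_left₀ (norm_nonneg _) h _).trans (le_of_eq ?_)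
    rw [hnorm, mul_pow, mul_pow, ← rpow_mul_natCast (norm_nonneg _), ← rpow_mul_natCast hd.le]
    push_cast
    rw [neg_mul, neg_mul, mul_right_comm]
  · rw [intervalIntegral.integral_const_mul]
    gcongr
    exact integral_norm_one_sub_circleMap_rpow_neg_le hr hr1 hk

/-- Power norm estimate for an `(α,β)`-RK operator when `α(k+1) > 1`:
`‖T^n‖ ≤ M n^((α+β−1)(k+1))` for all sufficiently large `n`. -/
theorem power_norm_bound_of_gt_one
    {X : Type*} [NormedAddCommGroup X] [NormedSpace ℂ X] [CompleteSpace X]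
    (T : X →L[ℂ] X) (α β C : ℝ) (hα : 0 ≤ α) (hβ : 0 ≤ β) (hT : IsRK T α β C)
    (k : ℕ) (hk : 1 < α * (k + 1)) :
    ∃ M > (0 : ℝ), ∃ N : ℕ, ∀ n : ℕ, N ≤ n →
      ‖T ^ n‖ ≤ M * (n : ℝ) ^ ((α + β - 1) * (k + 1)) := by
  have hC : 0 < C := zero_lt_one.trans_le hT.1
  have hs : 0 < α * (k + 1) - 1 := by linarith
  refine ⟨k ! * ((2 * π)⁻¹ * (C ^ (k + 1) * (5 ^ (α * (k + 1)) * (2 / (α * (k + 1) - 1)))) *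
    exp 2), by positivity, 2, fun n hn => ?_⟩
  have hn' : (2 : ℝ) ≤ n := by exact_mod_cast hn
  have hn0 : (0 : ℝ) < n := by linarith
  have hi : (n : ℝ)⁻¹ ≤ 1 / 2 := by
    rw [inv_le_comm₀ (by linarith) (by norm_num)]; norm_num; exact hn
  have hi0 : 0 < (n : ℝ)⁻¹ := by positivity
  have h1 := choose_mul_norm_pow_le_circle_average T k n (r := 1 - (n : ℝ)⁻¹) (by linarith)
    fun z hz => hT.isUnit_one_sub_smul (by linarith)
  have h2 := hT.integral_norm_inverse_pow_le hk (r := 1 - (n : ℝ)⁻¹) (by linarith) (by linarith)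
  have h3 := inv_one_sub_inv_pow_le_exp_two hn
  have h4 : (n : ℝ) ^ k ≤ k ! * (n + k).choose k := by
    have := Nat.pow_succ_le_ascFactorial (n + 1) k
    rw [Nat.ascFactorial_eq_factorial_mul_choose] at this
    calc (n : ℝ) ^ k ≤ (n + 1 : ℝ) ^ k := by gcongr; linarith
      _ ≤ _ := by exact_mod_cast this
  have hr0 : 0 ≤ (1 - (n : ℝ)⁻¹)⁻¹ := inv_nonneg.2 (by linarith)
  rw [sub_sub_cancel, inv_rpow hn0.le, inv_rpow hn0.le, ← rpow_neg hn0.le, ← rpow_neg hn0.le,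
    neg_neg, neg_sub] at h2
  have h5 : (n : ℝ) ^ k * ‖T ^ n‖ ≤ k ! * ((2 * π)⁻¹ * (C ^ (k + 1) * (n : ℝ) ^ (β * (k + 1)) *
      (5 ^ (α * (k + 1)) * (2 * ((n : ℝ) ^ (α * (k + 1) - 1) / (α * (k + 1) - 1))))) * exp 2) := by
    calc (n : ℝ) ^ k * ‖T ^ n‖ ≤ k ! * (n + k).choose k * ‖T ^ n‖ := by gcongr
      _ = k ! * ((n + k).choose k * ‖T ^ n‖) := mul_assoc _ _ _
      _ ≤ _ := by
        refine mul_le_mul_of_nonneg_left (h1.trans ?_) (by positivity)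
        gcongr
  have e : (n : ℝ) ^ (β * (k + 1)) * (n : ℝ) ^ (α * (k + 1) - 1) =
      (n : ℝ) ^ ((α + β - 1) * (k + 1)) * (n : ℝ) ^ k := by
    rw [← rpow_natCast, ← rpow_add hn0, ← rpow_add hn0]
    congr 1
    ring
  refine le_of_mul_le_mul_left (h5.trans (le_of_eq ?_)) (pow_pos hn0 k)
  linear_combination (k ! * ((2 * π)⁻¹ * (C ^ (k + 1) * (5 ^ (α * (k + 1)) *
    (2 / (α * (k + 1) - 1)))) * exp 2)) * e
end
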